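/- arXiv:1308.1499 — 3 statements merged into one kernel-verified Lean document; each statement's English description precedes it below -/
import Mathlib

section
/- Let G be a discrete group and A an infinite subset of G. Then A is prethick if and only if there exist a free ultrafilter p ∈ G* and a finite subset F of G such that ϑ_p(FA) = Gp. -/
open Pointwise

/-- The extension of the group multiplication to `βG`, the space of ultrafilters on `G`:
`A ∈ uMul p q ↔ {g : g⁻¹A ∈ q} ∈ p`. -/
def uMul {G : Type*} [Group G] (p q : Ultrafilter G) : Ultrafilter G :=
  p.bind fun g => q.map (g * ·)

/-- An ultrafilter is free if it is not principal. -/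
def uFree {G : Type*} (p : Ultrafilter G) : Prop := ∀ g : G, p ≠ pure g

/-- `A* = Ā ∩ G*`, the set of free ultrafilters containing `A`. -/
def uStar {G : Type*} (A : Set G) : Set (Ultrafilter G) := {p | A ∈ p ∧ uFree p}

/-- `Gp = {gp : g ∈ G}`. -/
def uOrbit {G : Type*} [Group G] (p : Ultrafilter G) : Set (Ultrafilter G) :=
  {q | ∃ g : G, q = uMul (pure g) p}

/-- The `p`-companion of `A`: `ϑ_p(A) = A* ∩ Gp`. -/
def uCompanion {G : Type*} [Group G] (A : Set G) (p : Ultrafilter G) : Set (Ultrafilter G) :=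
  uStar A ∩ uOrbit p

/-- A set is sparse if all its ultracompanions are finite. -/
def uSparse {G : Type*} [Group G] (A : Set G) : Prop :=
  ∀ p : Ultrafilter G, uFree p → (uCompanion A p).Finite

/-- A set is disparse if all its ultracompanions are discrete subspaces of `βG`. -/
def uDisparse {G : Type*} [Group G] (A : Set G) : Prop :=
  ∀ p : Ultrafilter G, uFree p → DiscreteTopology (uCompanion A p)

/-- `A` is large if `G = FA` for some finite `F`. -/
def uLarge {G : Type*} [Group G] (A : Set G) : Prop :=
  ∃ F : Set G, F.Finite ∧ (Set.univ : Set G) = F * A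

/-- `A` is thick if every finite set has a right translate inside `A` with translating
element from `A`. -/
def uThick {G : Type*} [Group G] (A : Set G) : Prop :=
  ∀ F : Set G, F.Finite → ∃ a ∈ A, (· * a) '' F ⊆ A

/-- `A` is prethick if `FA` is thick for some finite `F`. -/
def uPrethick {G : Type*} [Group G] (A : Set G) : Prop :=
  ∃ F : Set G, F.Finite ∧ uThick (F * A)

/-- `A` is small if `L \ A` is large for every large `L`. -/
def uSmall {G : Type*} [Group G] (A : Set G) : Prop :=
  ∀ L : Set G, uLarge L → uLarge (L \ A)

/-- `A` is thin if `gA ∩ A` is finite for all `g ≠ e`. -/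
def uThin {G : Type*} [Group G] (A : Set G) : Prop :=
  ∀ g : G, g ≠ 1 → (g • A ∩ A).Finite

/-- `FP(a_n) = {a_{i₁} ⋯ a_{i_n} : i₁ < ⋯ < i_n}`. -/
def uFP {G : Type*} [Group G] (a : ℕ → G) : Set G :=
  {g | ∃ l : List ℕ, l ≠ [] ∧ l.Pairwise (· < ·) ∧ g = (l.map a).prod}

theorem mem_uMul_pure {G : Type*} [Group G] (g : G) (p : Ultrafilter G) (B : Set G) :
    B ∈ uMul (pure g) p ↔ {x | g * x ∈ B} ∈ p := by
  rfl

theorem uFree_uMul_pure {G : Type*} [Group G] (g : G) (p : Ultrafilter G) (hp : uFree p) :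
    uFree (uMul (pure g) p) := by
  intro h hh
  apply hp (g⁻¹ * h)
  have h1 : {h} ∈ uMul (pure g) p := by
    rw [hh, Ultrafilter.mem_pure]; rfl
  rw [mem_uMul_pure] at h1
  have h2 : {g⁻¹ * h} ∈ p := by
    filter_upwards [h1] with x hx
    have hx' : g * x = h := hx
    rw [← hx']; simp
  apply Ultrafilter.coe_le_coe.1
  rw [Ultrafilter.coe_pure, ← Filter.principal_singleton]
  exact Filter.le_principal_iff.2 h2

theorem exists_uFree_of_uThick {G : Type*} [Group G] [Infinite G] (B : Set G) (hB : uThick B) :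
    ∃ p : Ultrafilter G, uFree p ∧ ∀ g : G, {x | g * x ∈ B} ∈ p := by
  classical
  let T : Finset G × Finset G → Set G := fun KE => {x | x ∉ KE.2 ∧ ∀ k ∈ KE.1, k * x ∈ B}
  have hne : ∀ KE, (T KE).Nonempty := by
    rintro ⟨K, E⟩
    obtain ⟨H, hH⟩ := Infinite.exists_subset_card_eq G (E.card + 1)
    obtain ⟨a, -, ha⟩ := hB (↑(K * H)) (Finset.finite_toSet _)
    have : ∃ y ∈ H.image (· * a), y ∉ E := by
      apply Finset.exists_mem_notMem_of_card_lt_card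
      rw [Finset.card_image_of_injective _ (mul_left_injective a)]
      omega
    obtain ⟨y, hy, hyE⟩ := this
    obtain ⟨h, hh, rfl⟩ := Finset.mem_image.1 hy
    refine ⟨h * a, hyE, fun k hk => ?_⟩
    rw [← mul_assoc]
    exact ha ⟨k * h, Finset.mem_coe.2 (Finset.mul_mem_mul hk hh), rfl⟩
  have hdir : Directed (· ≥ ·) (fun KE => Filter.principal (T KE)) := by
    rintro ⟨K, E⟩ ⟨K', E'⟩
    refine ⟨⟨K ∪ K', E ∪ E'⟩, ?_, ?_⟩ <;>
    · simp only [ge_iff_le, Filter.principal_mono]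
      rintro x ⟨h1, h2⟩
      simp only [Finset.mem_union] at h1 h2
      exact ⟨fun h => h1 (by tauto), fun k hk => h2 k (by tauto)⟩
  have : (⨅ KE, Filter.principal (T KE)).NeBot :=
    Filter.iInf_neBot_of_directed' hdir fun KE => Filter.principal_neBot_iff.2 (hne KE)
  obtain ⟨p, hp⟩ := Ultrafilter.exists_le (⨅ KE, Filter.principal (T KE))
  have hT : ∀ KE, T KE ∈ p := fun KE => hp (Filter.mem_iInf_of_mem KE (Filter.mem_principal_self _))
  refine ⟨p, ?_, fun g => ?_⟩
  · rintro g rfl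
    have := hT (∅, {g})
    rw [Ultrafilter.mem_pure] at this
    exact this.1 (by simp)
  · filter_upwards [hT ({g}, ∅)] with x hx
    exact hx.2 g (by simp)

/-- Proposition 3(ii): `A` is prethick iff `ϑ_p(FA) = Gp` for some `p ∈ G*` and finite `F`. -/
theorem statement5 {G : Type*} [Group G] (A : Set G) (hA : A.Infinite) :
    uPrethick A ↔ ∃ p : Ultrafilter G, uFree p ∧
      ∃ F : Set G, F.Finite ∧ uCompanion (F * A) p = uOrbit p := by
  have : Infinite G := Set.infinite_univ_iff.1 (hA.mono (Set.subset_univ A))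
  constructor
  · rintro ⟨F, hF, hT⟩
    obtain ⟨p, hp, h⟩ := exists_uFree_of_uThick _ hT
    refine ⟨p, hp, F, hF, ?_⟩
    apply Set.inter_eq_right.2
    rintro q ⟨g, rfl⟩
    exact ⟨(mem_uMul_pure g p _).2 (h g), uFree_uMul_pure g p hp⟩
  · rintro ⟨p, hp, F, hF, h⟩
    refine ⟨F, hF, fun K hK => ?_⟩
    have h1 : ∀ g : G, {x | g * x ∈ F * A} ∈ p := fun g =>
      (mem_uMul_pure g p _).1 ((Set.inter_eq_right.1 h) ⟨g, rfl⟩).1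
    have h2 : (⋂ g ∈ K, {x | g * x ∈ F * A}) ∈ (p : Filter G) :=
      (Filter.biInter_mem hK).2 fun g _ => h1 g
    obtain ⟨a, ha1, ha2⟩ := p.neBot.nonempty_of_mem (Filter.inter_mem (h1 1) h2)
    refine ⟨a, by simpa using ha1, ?_⟩
    rintro _ ⟨k, hk, rfl⟩
    exact Set.mem_iInter₂.1 ha2 k hk
end

section
/- Let G be a discrete group and A an infinite subset of G. Then A is thin if and only if |ϑ_p(A)| ≤ 1 for every free ultrafilter p ∈ G*. -/
open Pointwise

theorem aux_mul {G : Type*} [Group G] (g : G) (p : Ultrafilter G) (S : Set G) :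
    S ∈ uMul (pure g) p ↔ {x | g * x ∈ S} ∈ p := by
  rfl

theorem aux_free {G : Type*} {p : Ultrafilter G} (hp : uFree p) {S : Set G} (hS : S.Finite) :
    S ∉ p := by
  intro h
  obtain ⟨x, _, hx⟩ := Ultrafilter.eq_pure_of_finite_mem hS h
  exact hp x hx

theorem aux_free_mul {G : Type*} [Group G] (g : G) {p : Ultrafilter G} (hp : uFree p) :
    uFree (uMul (pure g) p) := by
  intro x h
  have h1 : ({x} : Set G) ∈ uMul (pure g) p := by
    rw [h]; exact Ultrafilter.mem_pure.2 rfl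
  rw [aux_mul] at h1
  refine aux_free hp ?_ h1
  apply (Set.finite_singleton (g⁻¹ * x)).subset
  intro y hy
  have hy : g * y = x := hy
  simp [← hy]

theorem aux_exists {G : Type*} [Group G] (g : G) (hg : g ≠ 1) (C : Set G) (hC : C.Infinite) :
    ∃ B ⊆ C, B.Infinite ∧ ∀ x ∈ B, g * x ∉ B := by
  obtain ⟨B, hB⟩ := zorn_subset {B : Set G | B ⊆ C ∧ ∀ x ∈ B, g * x ∉ B} (by
    intro c hc hch
    refine ⟨⋃₀ c, ⟨Set.sUnion_subset fun s hs => (hc hs).1, ?_⟩,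
      fun s hs => Set.subset_sUnion_of_mem hs⟩
    rintro x ⟨s, hs, hxs⟩ ⟨t, ht, hxt⟩
    rcases hch.total hs ht with h | h
    · exact (hc ht).2 x (h hxs) hxt
    · exact (hc hs).2 x hxs (h hxt))
  refine ⟨B, hB.prop.1, ?_, hB.prop.2⟩
  intro hfin
  apply hC
  apply ((hfin.union (hfin.image (g * ·))).union (hfin.image (g⁻¹ * ·))).subset
  intro x hx
  by_contra hn
  simp only [Set.mem_union, Set.mem_image, not_or, not_exists, not_and] at hn
  obtain ⟨⟨h1, h2⟩, h3⟩ := hn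
  refine h1 (hB.le_of_ge (y := insert x B) ⟨Set.insert_subset hx hB.prop.1, ?_⟩
    (Set.subset_insert _ _) (Set.mem_insert _ _))
  rintro y (rfl | hy) (h | h)
  · exact hg (by simpa using h)
  · exact h3 _ h (by simp)
  · exact h2 _ hy h
  · exact hB.prop.2 y hy h

/-- Proposition 3(iv): `A` is thin iff `|ϑ_p(A)| ≤ 1` for every `p ∈ G*`. -/
theorem statement7 {G : Type*} [Group G] (A : Set G) (hA : A.Infinite) :
    uThin A ↔ ∀ p : Ultrafilter G, uFree p → (uCompanion A p).encard ≤ 1 := by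
  constructor
  · intro h p hp
    rw [Set.encard_le_one_iff]
    rintro _ _ ⟨⟨hAq, hq⟩, g, rfl⟩ ⟨⟨hAr, hr⟩, k, rfl⟩
    by_cases hgk : g = k
    · rw [hgk]
    exfalso
    have hne : k * g⁻¹ ≠ 1 := fun h => hgk (mul_inv_eq_one.1 h).symm
    refine aux_free hr (h _ hne) ?_
    rw [aux_mul] at *
    filter_upwards [hAq, hAr] with x h1 h2
    refine ⟨⟨g * x, h1, ?_⟩, h2⟩
    simp [mul_assoc]
  · intro h g hg
    by_contra hinf
    obtain ⟨B, hBC, hB, hd⟩ := aux_exists g⁻¹ (inv_ne_one.2 hg) _ hinf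
    haveI := hB.cofinite_inf_principal_neBot
    let q : Ultrafilter G := Ultrafilter.of (Filter.cofinite ⊓ Filter.principal B)
    have hle := Ultrafilter.of_le (Filter.cofinite ⊓ Filter.principal B)
    have hBq : B ∈ q := hle (Filter.mem_inf_of_right (Filter.mem_principal_self B))
    have hq : uFree q := by
      intro x hx
      have h1 : ({x}ᶜ : Set G) ∈ q :=
        hle (Filter.mem_inf_of_left (Set.finite_singleton x).compl_mem_cofinite)
      rw [hx] at h1
      exact (Ultrafilter.mem_pure.1 h1) rfl
    have h1 : q ∈ uCompanion A q := by
      refine ⟨⟨Filter.mem_of_superset hBq fun x hx => (hBC hx).2, hq⟩, 1, ?_⟩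
      ext S
      rw [aux_mul]; simp
    have h2 : uMul (pure g⁻¹) q ∈ uCompanion A q := by
      refine ⟨⟨?_, aux_free_mul _ hq⟩, g⁻¹, rfl⟩
      rw [aux_mul]
      filter_upwards [hBq] with x hx
      exact Set.mem_smul_set_iff_inv_smul_mem.1 (hBC hx).1
    have he := Set.encard_le_one_iff.1 (h q hq) _ _ h1 h2
    have hB2 : B ∈ uMul (pure g⁻¹) q := he ▸ hBq
    rw [aux_mul] at hB2
    obtain ⟨x, hx1, hx2⟩ := q.nonempty_of_mem (Filter.inter_mem hBq hB2)
    exact hd x hx1 hx2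
end

section
/- Let G be a discrete group and A a subset of G. Then A is sparse in G if and only if for every countable subgroup H of G the set A ∩ H is sparse in H. -/
open Pointwise

theorem aux_uMul_pure {G : Type*} [Group G] (g : G) (p : Ultrafilter G) :
    uMul (pure g) p = p.map (g * ·) := by
  apply Ultrafilter.coe_injective
  ext s
  rfl

theorem aux_uFree_iff {G : Type*} (p : Ultrafilter G) :
    uFree p ↔ ∀ g : G, {g} ∉ p := by
  refine forall_congr' fun g => not_congr ⟨?_, ?_⟩
  · rintro rfl
    exact Ultrafilter.mem_pure.2 rfl
  · intro h
    apply Ultrafilter.coe_injective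
    refine le_antisymm ?_ ?_
    · rw [Ultrafilter.coe_pure]; exact Filter.le_pure_iff.2 h
    · have : (p : Filter G) ≤ ((pure g : Ultrafilter G) : Filter G) := by
        rw [Ultrafilter.coe_pure]; exact Filter.le_pure_iff.2 h
      rw [Ultrafilter.coe_le_coe.1 this]

theorem aux_uFree_map {G K : Type*} (f : K → G) (hf : Function.Injective f)
    (p : Ultrafilter K) (hp : uFree p) : uFree (p.map f) := by
  rw [aux_uFree_iff] at hp ⊢
  intro g hg
  rw [Ultrafilter.mem_map] at hg
  obtain ⟨k, hk⟩ := Ultrafilter.nonempty_of_mem hg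
  refine hp k ?_
  filter_upwards [hg] with x hx
  exact hf ((Set.mem_singleton_iff.1 hx).trans (Set.mem_singleton_iff.1 hk).symm)

theorem aux_uFree_notMem {G : Type*} (p : Ultrafilter G) (hp : uFree p) (s : Set G)
    (hs : s.Finite) : s ∉ p := by
  intro h
  obtain ⟨x, _, hx⟩ := Ultrafilter.eq_pure_of_finite_mem hs h
  exact hp x hx

theorem aux_seq {G : Type*} [Group G] (A : Set G) (p : Ultrafilter G) (hp : uFree p)
    (g : ℕ → G) (hg : ∀ n, A ∈ p.map (g n * ·)) :
    ∃ x : ℕ → G, (∀ i k, i ≤ k → g i * x k ∈ A) ∧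
      ∀ l k, l < k → ∀ i j, i ≤ k → j ≤ k → (g i)⁻¹ * g j * x l ≠ x k := by
  classical
  obtain ⟨f, hf1, hf2⟩ := exists_seq_of_forall_finset_exists
    (fun a : ℕ × G => ∀ i ≤ a.1, g i * a.2 ∈ A)
    (fun a b => a.1 < b.1 ∧ ∀ i j, i ≤ b.1 → j ≤ b.1 → (g i)⁻¹ * g j * a.2 ≠ b.2) (by
      intro s _
      let m := s.sup Prod.fst + 1
      let B : Set G := ⋃ a ∈ s, ⋃ i ∈ Finset.range (m+1), ⋃ j ∈ Finset.range (m+1),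
        {(g i)⁻¹ * g j * a.2}
      have hB : B.Finite := by
        refine s.finite_toSet.biUnion fun a _ => ?_
        refine (Finset.range (m+1)).finite_toSet.biUnion fun i _ => ?_
        refine (Finset.range (m+1)).finite_toSet.biUnion fun j _ => ?_
        exact Set.finite_singleton _
      have h1 : Bᶜ ∈ p := Ultrafilter.compl_mem_iff_notMem.2 (aux_uFree_notMem p hp B hB)
      have h2 : (⋂ i ∈ Finset.range (m+1), {x | g i * x ∈ A}) ∈ (p : Filter G) :=
        (Filter.biInter_finset_mem _).2 fun i _ => hg i
      obtain ⟨x, hx1, hx2⟩ := Ultrafilter.nonempty_of_mem (Filter.inter_mem h1 h2)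
      refine ⟨(m, x), ?_, ?_⟩
      · intro i hi
        simp only [Set.mem_iInter] at hx2
        exact hx2 i (Finset.mem_range.2 (Nat.lt_succ_of_le hi))
      · intro a ha
        refine ⟨Nat.lt_succ_of_le (Finset.le_sup (f := Prod.fst) ha), ?_⟩
        intro i j hi hj he
        apply hx1
        simp only [B, Set.mem_iUnion]
        exact ⟨a, ha, i, Finset.mem_range.2 (Nat.lt_succ_of_le hi), j,
          Finset.mem_range.2 (Nat.lt_succ_of_le hj), he.symm⟩)
  have hmono : StrictMono (fun n => (f n).1) := fun a b h => (hf2 a b h).1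
  refine ⟨fun n => (f n).2, fun i k h => hf1 k i (h.trans (hmono.id_le k)), ?_⟩
  intro l k h i j hi hj
  exact (hf2 l k h).2 i j (hi.trans (hmono.id_le k)) (hj.trans (hmono.id_le k))

/-- Proposition 6: `A` is sparse iff `A ∩ H` is sparse in `H` for every countable
subgroup `H` of `G`. -/
theorem statement11 {G : Type*} [Group G] (A : Set G) :
    uSparse A ↔ ∀ H : Subgroup G, Countable H →
      uSparse {h : H | (h : G) ∈ A} := by
  constructor
  · intro hA H _ p hp
    have hinj : Function.Injective (Ultrafilter.map (Subtype.val : H → G)) := by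
      intro a b h
      apply Ultrafilter.coe_injective
      apply Filter.map_injective Subtype.val_injective
      exact congrArg (fun u : Ultrafilter G => (u : Filter G)) h
    refine Set.Finite.of_finite_image (f := Ultrafilter.map (Subtype.val : H → G))
      ((hA (p.map Subtype.val) (aux_uFree_map _ Subtype.val_injective p hp)).subset ?_)
      hinj.injOn
    rintro _ ⟨q, ⟨⟨hq1, hq2⟩, g, rfl⟩, rfl⟩
    refine ⟨⟨hq1, aux_uFree_map _ Subtype.val_injective _ hq2⟩, (g : G), ?_⟩
    rw [aux_uMul_pure, aux_uMul_pure, Ultrafilter.map_map, Ultrafilter.map_map]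
    rfl
  · intro h p hp
    by_contra hinf
    have hinf : (uCompanion A p).Infinite := hinf
    let e := hinf.natEmbedding
    have he : ∀ n, ∃ g : G, (e n : Ultrafilter G) = p.map (g * ·) := by
      intro n
      obtain ⟨g, hg⟩ := (e n).2.2
      exact ⟨g, hg.trans (aux_uMul_pure g p)⟩
    choose g hg using he
    have hginj : Function.Injective g := by
      intro a b hab
      apply e.injective
      apply Subtype.ext
      rw [hg, hg, hab]
    obtain ⟨x, hx1, hx2⟩ := aux_seq A p hp g (fun n => hg n ▸ (e n).2.1.1)
    let S : Set G := Set.range g ∪ Set.range x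
    have hS : S.Countable := (Set.countable_range g).union (Set.countable_range x)
    let H := Subgroup.closure S
    have : Countable S := hS
    have hH : Countable H := by
      have hc : Countable (FreeGroup S) := by
        unfold FreeGroup
        infer_instance
      have hr : (FreeGroup.lift (Subtype.val : S → G)).range = H := by
        rw [FreeGroup.range_lift_eq_closure, Subtype.range_coe]
      rw [← hr]
      exact (Set.countable_range (FreeGroup.lift (Subtype.val : S → G))).to_subtype
    let g' : ℕ → H := fun n => ⟨g n, Subgroup.subset_closure (Or.inl ⟨n, rfl⟩)⟩
    let x' : ℕ → H := fun n => ⟨x n, Subgroup.subset_closure (Or.inr ⟨n, rfl⟩)⟩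
    have hxlt : ∀ a b, a < b → x a ≠ x b := by
      intro a b hab
      simpa using hx2 a b hab 0 0 (Nat.zero_le _) (Nat.zero_le _)
    have hxinj : Function.Injective x' := by
      intro a b hab
      have hab : x a = x b := congrArg Subtype.val hab
      by_contra hne
      rcases lt_or_gt_of_ne hne with h1 | h1
      · exact hxlt a b h1 hab
      · exact hxlt b a h1 hab.symm
    have hfr : uFree (Filter.hyperfilter ℕ) := by
      rw [aux_uFree_iff]
      intro n
      exact Set.Finite.notMem_hyperfilter (Set.finite_singleton n)
    let q : Ultrafilter H := (Filter.hyperfilter ℕ).map x'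
    have hq : uFree q := aux_uFree_map _ hxinj _ hfr
    have hge : ∀ m : ℕ, {k | m ≤ k} ∈ Filter.hyperfilter ℕ := by
      intro m
      have : {k | m ≤ k}ᶜ.Finite := (Set.finite_lt_nat m).subset fun k hk => by simpa using hk
      exact Filter.mem_hyperfilter_of_finite_compl this
    refine Set.not_infinite.2 (h H hH q hq) ?_
    refine Set.infinite_of_injective_forall_mem (f := fun n => q.map (g' n * ·)) ?_ ?_
    · intro i j hij
      by_contra hne
      let m := max i j
      have h1 : (fun k => g' i * x' k) '' {k | m ≤ k} ∈ q.map (g' i * ·) := by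
        change _ ∈ Filter.hyperfilter ℕ
        filter_upwards [hge m] with k hk
        exact ⟨k, hk, rfl⟩
      have h2 : (fun k => g' j * x' k) '' {k | m ≤ k} ∈ q.map (g' i * ·) := by
        have hij : q.map (g' i * ·) = q.map (g' j * ·) := hij
        rw [hij]
        change _ ∈ Filter.hyperfilter ℕ
        filter_upwards [hge m] with k hk
        exact ⟨k, hk, rfl⟩
      obtain ⟨y, ⟨k, hk, rfl⟩, ⟨l, hl, hkl⟩⟩ :=
        Ultrafilter.nonempty_of_mem (Filter.inter_mem h1 h2)
      have hkl : g j * x l = g i * x k := congrArg Subtype.val hkl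
      have hk : max i j ≤ k := hk
      have hl : max i j ≤ l := hl
      rcases lt_trichotomy l k with h3 | h3 | h3
      · refine hx2 l k h3 i j (by omega) (by omega) ?_
        rw [mul_assoc, hkl, inv_mul_cancel_left]
      · subst h3
        exact hne (hginj (mul_right_cancel hkl).symm)
      · refine hx2 k l h3 j i (by omega) (by omega) ?_
        rw [mul_assoc, ← hkl, inv_mul_cancel_left]
    · intro n
      refine ⟨⟨?_, aux_uFree_map _ (mul_right_injective _) _ hq⟩, g' n, (aux_uMul_pure _ _).symm⟩
      change _ ∈ Filter.hyperfilter ℕ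
      filter_upwards [hge n] with k hk
      exact hx1 n k hk
end
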